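/- Let p = 2^t − 1 be prime (t ≥ 2), x = p − 1, and let P_n be the distribution on Z_p of Z_n = 2^{n−1}b_1 + ⋯ + b_n mod p, where b_1, …, b_n are i.i.d. block increments (this is the distribution of the block walk started at 0 after n steps). If n = r·t for a positive integer r, then E_{P_n}(f) = t·Π_1^r and E_{P_n}(f·f̄) = t·∑_{β=0}^{t−1} Π_β^r, where f(k) = ∑_{j=0}^{t−1} e^{2πik·2^j/p} and Π_j = ∏_{α=0}^{t−1} G(2^α(2^j−1)/p) with θ = (3−√5)/2 and G(y) = (1/√5)(1−θ²)/(1+θ²−2θcos(2πy)). -/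

import Mathlib

open Finset

/-- The distribution of a block increment `b = ε₁ + ⋯ + ε_M mod N`, where `M` is geometric
(`Pr[M = k] = (1/3)(2/3)^k`) and the `εᵢ` are i.i.d. uniform on `{1, x}`. -/
noncomputable def blockPMF (N : ℕ) (x : ZMod N) (b : ZMod N) : ℝ :=
  ∑' k : ℕ, (1 / 3 : ℝ) * (1 / 3) ^ k *
    ∑ a ∈ Finset.range (k + 1),
      (k.choose a : ℝ) *
        (if (a : ZMod N) + ((k - a : ℕ) : ZMod N) * x = b then 1 else 0)

/-- `nu N x n j = Pr[Z_n = j]` where `Z_n = 2^{n−1}b₁ + ⋯ + b_n mod N` for i.i.d.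
block increments `b₁, …, b_n`; this is the distribution of the block walk started
at `0` after `n` steps. -/
noncomputable def nu (N : ℕ) [NeZero N] (x : ZMod N) (s : ℕ) (j : ZMod N) : ℝ :=
  ∑ b : Fin s → ZMod N,
    (∏ i, blockPMF N x (b i)) *
      (if (∑ i : Fin s, (2 : ZMod N) ^ (s - 1 - (i : ℕ)) * b i) = j then 1 else 0)

/-- The separating function `f(k) = ∑_{j=0}^{t−1} e^{2πik·2^j/p}`. -/
noncomputable def fsep (p t : ℕ) [NeZero p] (k : ZMod p) : ℂ :=
  ∑ j ∈ Finset.range t,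
    Complex.exp (2 * Real.pi * Complex.I * (k.val : ℂ) * (2 : ℂ) ^ j / (p : ℂ))

/-- `G(y) = (1/√5)·(1 − θ²)/(1 + θ² − 2θ·cos(2πy))` with `θ = (3−√5)/2`. -/
noncomputable def Gfun (y : ℝ) : ℝ :=
  (1 / Real.sqrt 5) * (1 - ((3 - Real.sqrt 5) / 2) ^ 2) /
    (1 + ((3 - Real.sqrt 5) / 2) ^ 2 -
      2 * ((3 - Real.sqrt 5) / 2) * Real.cos (2 * Real.pi * y))

/-- `Π_j = ∏_{α=0}^{t−1} G(2^α(2^j−1)/p)` where `p = 2^t − 1`. -/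
noncomputable def PiProd (t j : ℕ) : ℝ :=
  ∏ α ∈ Finset.range t, Gfun ((2 : ℝ) ^ α * ((2 : ℝ) ^ j - 1) / ((2 : ℝ) ^ t - 1))

section BlockIncrement

variable {N : ℕ}

lemma hasSum_blockPMF (x b : ZMod N) :
    HasSum (fun k : ℕ => (1 / 3 : ℝ) * (1 / 3) ^ k *
      ∑ a ∈ Finset.range (k + 1), (k.choose a : ℝ) *
        (if (a : ZMod N) + ((k - a : ℕ) : ZMod N) * x = b then 1 else 0)) (blockPMF N x b) := by
  refine Summable.hasSum (Summable.of_nonneg_of_le (fun k => ?_) (fun k => ?_)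
    (summable_geometric_of_lt_one (r := (2 / 3 : ℝ)) (by norm_num) (by norm_num)))
  · refine mul_nonneg (by positivity) (Finset.sum_nonneg fun a _ => ?_)
    split_ifs <;> simp
  · have h : ∑ a ∈ Finset.range (k + 1), (k.choose a : ℝ) *
        (if (a : ZMod N) + ((k - a : ℕ) : ZMod N) * x = b then 1 else 0) ≤ 2 ^ k := by
      calc _ ≤ ∑ a ∈ Finset.range (k + 1), (k.choose a : ℝ) := by
            refine Finset.sum_le_sum fun a _ => ?_
            split_ifs <;> simp
        _ = 2 ^ k := by exact_mod_cast Nat.sum_range_choose k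
    calc _ ≤ (1 / 3 : ℝ) * (1 / 3) ^ k * 2 ^ k := by gcongr
      _ = 1 / 3 * (2 / 3) ^ k := by rw [mul_assoc, ← mul_pow]; norm_num
      _ ≤ (2 / 3) ^ k := by
        have : (0 : ℝ) ≤ (2 / 3) ^ k := by positivity
        linarith

variable [NeZero N]

lemma sum_choose_indicator_addChar (ψ : AddChar (ZMod N) ℂ) (x : ZMod N) (k : ℕ) :
    ∑ b : ZMod N, (((∑ a ∈ Finset.range (k + 1), (k.choose a : ℝ) *
        (if (a : ZMod N) + ((k - a : ℕ) : ZMod N) * x = b then 1 else 0) : ℝ)) : ℂ) * ψ b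
      = (ψ 1 + ψ x) ^ k := by
  push_cast
  simp_rw [Finset.sum_mul]
  rw [Finset.sum_comm, add_pow]
  refine Finset.sum_congr rfl fun a _ => ?_
  have h : ψ ((a : ZMod N) + ((k - a : ℕ) : ZMod N) * x) = ψ 1 ^ a * ψ x ^ (k - a) := by
    rw [AddChar.map_add_eq_mul, ← nsmul_eq_mul, AddChar.map_nsmul_eq_pow,
      ← AddChar.map_nsmul_eq_pow ψ a 1, nsmul_one]
  rw [← h]
  simp_rw [mul_assoc, ← Finset.mul_sum]
  simp [apply_ite Complex.ofReal, mul_comm]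

/-- The Fourier transform of the block increment. -/
lemma sum_blockPMF_mul_addChar (ψ : AddChar (ZMod N) ℂ) (x : ZMod N) :
    ∑ b : ZMod N, (blockPMF N x b : ℂ) * ψ b = (3 - (ψ 1 + ψ x))⁻¹ := by
  have h := hasSum_sum (s := Finset.univ) fun b (_ : b ∈ Finset.univ) =>
    ((Complex.hasSum_ofReal.2 (hasSum_blockPMF x b)).mul_right (ψ b))
  have hnorm : ‖ψ 1 + ψ x‖ ≤ 2 := by
    calc _ ≤ ‖ψ 1‖ + ‖ψ x‖ := norm_add_le _ _
      _ = 2 := by rw [AddChar.norm_apply, AddChar.norm_apply]; norm_num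
  have hlt : ‖(ψ 1 + ψ x) / 3‖ < 1 := by
    rw [norm_div, Complex.norm_ofNat]; linarith
  have hgeom := (hasSum_geometric_of_norm_lt_one hlt).mul_left (1 / 3 : ℂ)
  have hne : 3 - (ψ 1 + ψ x) ≠ 0 := by
    intro h0
    rw [← sub_eq_zero.1 h0] at hnorm
    norm_num at hnorm
  refine (h.unique ?_).trans (b := 1 / 3 * (1 - (ψ 1 + ψ x) / 3)⁻¹) ?_
  · convert hgeom using 2 with k
    simp only [div_pow (ψ 1 + ψ x)]
    rw [← sum_choose_indicator_addChar ψ x k, Finset.sum_div, Finset.mul_sum]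
    refine Finset.sum_congr rfl fun b _ => ?_
    push_cast
    rw [one_div_pow]
    ring
  · rw [one_sub_div (by norm_num), inv_div]
    field_simp

/-- The Fourier transform of the block walk factors over its steps. -/
lemma sum_nu_mul_addChar (ψ : AddChar (ZMod N) ℂ) (x : ZMod N) (s : ℕ) :
    ∑ k : ZMod N, (nu N x s k : ℂ) * ψ k
      = ∏ i ∈ Finset.range s, ∑ b : ZMod N, (blockPMF N x b : ℂ) * ψ (2 ^ i * b) := by
  rw [← Finset.prod_range_reflect,
    ← Fin.prod_univ_eq_prod_range
      (fun i => ∑ b : ZMod N, (blockPMF N x b : ℂ) * ψ (2 ^ (s - 1 - i) * b)) s,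
    Fintype.prod_sum]
  simp only [nu]
  push_cast
  simp_rw [Finset.sum_mul]
  rw [Finset.sum_comm]
  refine Finset.sum_congr rfl fun b _ => ?_
  have h : ψ (∑ i : Fin s, 2 ^ (s - 1 - (i : ℕ)) * b i)
      = ∏ i : Fin s, ψ (2 ^ (s - 1 - (i : ℕ)) * b i) :=
    map_prod ψ.toMonoidHom (fun i : Fin s => Multiplicative.ofAdd (2 ^ (s - 1 - (i : ℕ)) * b i)) _
  rw [Finset.prod_mul_distrib, ← h]
  simp_rw [mul_assoc, ← Finset.mul_sum]
  simp [apply_ite Complex.ofReal]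

lemma stdAddChar_eq_exp (m : ℤ) :
    ZMod.stdAddChar (N := N) (m : ZMod N)
      = Complex.exp ((2 * Real.pi * (m / N) : ℝ) * Complex.I) := by
  rw [ZMod.stdAddChar_coe]
  congr 1
  push_cast
  ring

/-- The character `b ↦ e^{2πicb/N}`. -/
noncomputable def freqChar (c : ZMod N) : AddChar (ZMod N) ℂ :=
  AddChar.mulShift ZMod.stdAddChar c

lemma freqChar_apply (c b : ZMod N) : freqChar c b = ZMod.stdAddChar (c * b) := rfl

end BlockIncrement

lemma Gfun_eq (y : ℝ) : Gfun y = (3 - 2 * Real.cos (2 * Real.pi * y))⁻¹ := by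
  have h5 : Real.sqrt 5 ^ 2 = 5 := Real.sq_sqrt (by norm_num)
  have hpos : 0 < Real.sqrt 5 := by positivity
  have hlt : Real.sqrt 5 < 3 := by nlinarith
  have hc : 0 < 3 - 2 * Real.cos (2 * Real.pi * y) := by
    linarith [Real.cos_le_one (2 * Real.pi * y)]
  have hden : 1 + ((3 - Real.sqrt 5) / 2) ^ 2 -
      2 * ((3 - Real.sqrt 5) / 2) * Real.cos (2 * Real.pi * y)
      = (3 - Real.sqrt 5) / 2 * (3 - 2 * Real.cos (2 * Real.pi * y)) := by
    linear_combination h5 / 4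
  have hnum : 1 / Real.sqrt 5 * (1 - ((3 - Real.sqrt 5) / 2) ^ 2) = (3 - Real.sqrt 5) / 2 := by
    field_simp
    linear_combination h5
  rw [Gfun, hden, hnum, div_mul_cancel_left₀ (by linarith)]

section Periodic

variable {M : Type*} [CommMonoid M] {F : ℕ → M} {t : ℕ}

@[to_additive]
lemma prod_range_add_of_periodic (hF : Function.Periodic F t) (j : ℕ) :
    ∏ i ∈ Finset.range t, F (i + j) = ∏ i ∈ Finset.range t, F i := by
  induction j with
  | zero => rfl
  | succ j ih =>
    rw [← ih]
    cases t with
    | zero => rfl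
    | succ t =>
      rw [Finset.prod_range_succ, Finset.prod_range_succ', ← hF (0 + j)]
      congr 1
      · exact Finset.prod_congr rfl fun i _ => by congr 1; ring
      · congr 1; ring

lemma prod_range_mul_of_periodic (hF : Function.Periodic F t) (r : ℕ) :
    ∏ i ∈ Finset.range (r * t), F i = (∏ i ∈ Finset.range t, F i) ^ r := by
  induction r with
  | zero => simp
  | succ r ih =>
    rw [Nat.succ_mul, Finset.prod_range_add, ih, pow_succ]
    congr 1
    refine Finset.prod_congr rfl fun i _ => ?_
    rw [add_comm]
    exact hF.nat_mul r i

end Periodic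

section Mersenne

variable {p t : ℕ}

lemma two_pow_eq_one_of_mersenne (hp : p = 2 ^ t - 1) : (2 : ZMod p) ^ t = 1 := by
  have h : 2 ^ t = p + 1 := by have := Nat.one_le_two_pow (n := t); omega
  have h' := congrArg (Nat.cast : ℕ → ZMod p) h
  push_cast at h'
  simpa using h'

lemma periodic_two_pow_mul (hp : p = 2 ^ t - 1) {α : Type*} (g : ZMod p → α) (c : ZMod p) :
    Function.Periodic (fun i : ℕ => g (2 ^ i * c)) t := by
  intro i
  simp only [pow_add, two_pow_eq_one_of_mersenne hp, mul_one]

variable [NeZero p]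

lemma sum_blockPMF_neg_one_mul_freqChar (m : ℤ) :
    ∑ b : ZMod p, (blockPMF p (-1) b : ℂ) * freqChar (m : ZMod p) b = (Gfun (m / p) : ℂ) := by
  rw [sum_blockPMF_mul_addChar, Gfun_eq, freqChar_apply, freqChar_apply, mul_one, mul_neg, mul_one,
    ← Int.cast_neg, stdAddChar_eq_exp, stdAddChar_eq_exp]
  have h : ((2 * Real.pi * ((-m : ℤ) / p) : ℝ) : ℂ) * Complex.I
      = -((2 * Real.pi * (m / p) : ℝ) : ℂ) * Complex.I := by push_cast; ring
  rw [h]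
  push_cast
  rw [Complex.two_cos]

/-- The Fourier transform at frequency `c` of the block walk with `x = -1` after `t` steps. -/
noncomputable def walkTransform (t : ℕ) (c : ZMod p) : ℂ :=
  ∏ i ∈ Finset.range t, ∑ b : ZMod p, (blockPMF p (-1) b : ℂ) * freqChar (2 ^ i * c) b

lemma walkTransform_two_pow_mul (hp : p = 2 ^ t - 1) (j : ℕ) (c : ZMod p) :
    walkTransform t (2 ^ j * c) = walkTransform t c := by
  rw [walkTransform, walkTransform, ← prod_range_add_of_periodic (periodic_two_pow_mul hp
    (fun d => ∑ b : ZMod p, (blockPMF p (-1) b : ℂ) * freqChar d b) c) j]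
  simp only [pow_add, mul_assoc]

lemma walkTransform_two_pow_sub_one (hp : p = 2 ^ t - 1) (β : ℕ) :
    walkTransform t ((2 : ZMod p) ^ β - 1) = (PiProd t β : ℂ) := by
  have hpR : (p : ℝ) = 2 ^ t - 1 := by
    rw [hp, Nat.cast_sub Nat.one_le_two_pow]; push_cast; rfl
  rw [walkTransform, PiProd, Complex.ofReal_prod]
  refine Finset.prod_congr rfl fun α _ => ?_
  have h := sum_blockPMF_neg_one_mul_freqChar (p := p) (2 ^ α * (2 ^ β - 1))
  push_cast at h
  rw [h, hpR]

lemma sum_nu_mul_freqChar (hp : p = 2 ^ t - 1) (r : ℕ) (c : ZMod p) :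
    ∑ k : ZMod p, (nu p (-1) (r * t) k : ℂ) * freqChar c k = walkTransform t c ^ r := by
  rw [sum_nu_mul_addChar, walkTransform, ← prod_range_mul_of_periodic (periodic_two_pow_mul hp
    (fun d => ∑ b : ZMod p, (blockPMF p (-1) b : ℂ) * freqChar d b) c)]
  refine Finset.prod_congr rfl fun i _ => Finset.sum_congr rfl fun b _ => ?_
  rw [freqChar_apply, freqChar_apply]
  congr 2
  ring

lemma fsep_eq_sum_freqChar (k : ZMod p) :
    fsep p t k = ∑ j ∈ Finset.range t, freqChar (2 ^ j : ZMod p) k := by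
  refine Finset.sum_congr rfl fun j _ => ?_
  have h : (2 ^ j : ZMod p) * k = ((2 ^ j * (k.val : ℤ) : ℤ) : ZMod p) := by
    push_cast; rw [ZMod.natCast_zmod_val]
  rw [freqChar_apply, h, stdAddChar_eq_exp]
  congr 1
  push_cast
  ring

lemma fsep_mul_conj_eq_sum_freqChar (k : ZMod p) :
    fsep p t k * (starRingEnd ℂ) (fsep p t k)
      = ∑ j ∈ Finset.range t, ∑ i ∈ Finset.range t, freqChar (2 ^ i - 2 ^ j : ZMod p) k := by
  rw [fsep_eq_sum_freqChar, map_sum, Finset.sum_mul_sum, Finset.sum_comm]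
  refine Finset.sum_congr rfl fun j _ => Finset.sum_congr rfl fun i _ => ?_
  rw [← AddChar.map_neg_eq_conj, freqChar_apply, freqChar_apply, freqChar_apply,
    ← AddChar.map_add_eq_mul]
  congr 1
  ring

end Mersenne

theorem block_walk_fourier_moments (t : ℕ) (ht : 2 ≤ t)
    (p : ℕ) [NeZero p] (hp : p = 2 ^ t - 1) (hprime : p.Prime)
    (r : ℕ) (hr : 1 ≤ r) (n : ℕ) (hn : n = r * t) :
    (∑ k : ZMod p, ((nu p ((p - 1 : ℕ) : ZMod p) n k : ℝ) : ℂ) * fsep p t k)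
        = (((t : ℝ) * PiProd t 1 ^ r : ℝ) : ℂ) ∧
    (∑ k : ZMod p, ((nu p ((p - 1 : ℕ) : ZMod p) n k : ℝ) : ℂ) *
          (fsep p t k * (starRingEnd ℂ) (fsep p t k)))
        = (((t : ℝ) * ∑ β ∈ Finset.range t, PiProd t β ^ r : ℝ) : ℂ) := by
  subst hn
  have hx : ((p - 1 : ℕ) : ZMod p) = -1 := by
    rw [Nat.cast_sub hprime.one_le]; simp
  rw [hx]
  constructor
  · simp_rw [fsep_eq_sum_freqChar, Finset.mul_sum]
    rw [Finset.sum_comm]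
    simp_rw [sum_nu_mul_freqChar hp]
    have h : ∀ j : ℕ, walkTransform t (2 ^ j : ZMod p) = (PiProd t 1 : ℂ) := fun j => by
      rw [← walkTransform_two_pow_sub_one hp 1, ← walkTransform_two_pow_mul hp j (2 ^ 1 - 1)]
      congr 1
      ring
    simp_rw [h]
    simp
  · simp_rw [fsep_mul_conj_eq_sum_freqChar, Finset.mul_sum]
    rw [Finset.sum_comm]
    have h : ∀ j ∈ Finset.range t, ∑ k : ZMod p, ∑ i ∈ Finset.range t,
        (nu p (-1) (r * t) k : ℂ) * freqChar (2 ^ i - 2 ^ j : ZMod p) k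
          = ∑ β ∈ Finset.range t, (PiProd t β : ℂ) ^ r := fun j _ => by
      rw [Finset.sum_comm]
      simp_rw [sum_nu_mul_freqChar hp]
      have hper := periodic_two_pow_mul hp (fun d => walkTransform t (d - 2 ^ j) ^ r) 1
      simp only [mul_one] at hper
      rw [← sum_range_add_of_periodic hper j]
      refine Finset.sum_congr rfl fun β _ => ?_
      rw [← walkTransform_two_pow_sub_one hp β, ← walkTransform_two_pow_mul hp j (2 ^ β - 1)]
      congr 2
      ring
    rw [Finset.sum_congr rfl h]
    simp [Finset.mul_sum]
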